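/- Let (Q,I) be a gentle quiver over a field K such that A = KQ/I is finite-dimensional, and let v be a vertex of Q such that the pair obtained from (Q,I) by adding a loop with square zero at v is again gentle (i.e. v can be chosen as a special vertex for a covering skewed-gentle quiver). Then the diagonal entry of the q-Cartan matrix C_A(q) at v equals 1, i.e. the only nonzero cyclic path at v in A is the trivial path. -/

import Mathlib

/-! Combinatorial model of a finite quiver with (quadratic monomial) relations.

For a monomial algebra `A = KQ/I` (with `I` generated by paths of length 2),
a basis of `e_i A e_j` is given by the paths from `i` to `j` avoiding the
relations, so all Cartan-type invariants are encoded combinatorially. -/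

/-- A finite quiver together with a set of quadratic (length two) monomial
relations: `rel a b` means that the length-two path `ab` belongs to the
relation ideal `I`. -/
structure QuivRel where
  /-- vertices -/
  V : Type
  /-- arrows -/
  A : Type
  [instVFin : Fintype V]
  [instVDec : DecidableEq V]
  [instAFin : Fintype A]
  [instADec : DecidableEq A]
  /-- start vertex of an arrow -/
  src : A → V
  /-- end vertex of an arrow -/
  tgt : A → V
  /-- the set of length-two zero relations -/
  rel : A → A → Prop
  rel_comp : ∀ a b, rel a b → tgt a = src b

attribute [instance] QuivRel.instVFin QuivRel.instVDec QuivRel.instAFin QuivRel.instADec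

namespace QuivRel

variable (G : QuivRel)

/-- Condition (i) and (ii): `(Q,I)` is special biserial (the relation ideal `I`
being generated by the paths of length two recorded in `rel`). -/
def SpecialBiserial : Prop :=
  (∀ v : G.V, Nat.card {a : G.A // G.src a = v} ≤ 2) ∧
  (∀ v : G.V, Nat.card {a : G.A // G.tgt a = v} ≤ 2) ∧
  (∀ a b c : G.A, G.tgt a = G.src b → ¬ G.rel a b → G.tgt a = G.src c → ¬ G.rel a c → b = c) ∧
  (∀ a b c : G.A, G.tgt b = G.src a → ¬ G.rel b a → G.tgt c = G.src a → ¬ G.rel c a → b = c)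

/-- `(Q,I)` is a gentle quiver: special biserial, `I` generated by paths of
length two (built into the data), and conditions (iv). -/
def Gentle : Prop :=
  G.SpecialBiserial ∧
  (∀ a b c : G.A, G.rel a b → G.rel a c → b = c) ∧
  (∀ a b c : G.A, G.rel b a → G.rel c a → b = c)

/-- A (composable) path all of whose length-two subpaths avoid the relations;
these are exactly the paths which are nonzero in the monomial algebra `KQ/I`. -/
def IsNonzeroPath (p : List G.A) : Prop :=
  p.Chain' (fun a b => G.tgt a = G.src b ∧ ¬ G.rel a b)

/-- Nonzero paths from `i` to `j`; the empty list is the trivial path `e_i`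
(so we require `i = j` for it). -/
def IsNonzeroPathFrom (i j : G.V) (p : List G.A) : Prop :=
  G.IsNonzeroPath p ∧ (∀ a ∈ p.head?, G.src a = i) ∧
    (∀ a ∈ p.getLast?, G.tgt a = j) ∧ (p = [] → i = j)

/-- Finite-dimensionality of `KQ/I`: nonzero paths have bounded length. -/
def FinDim : Prop := ∃ N, ∀ p : List G.A, G.IsNonzeroPath p → p.length ≤ N

/-- The `q`-Cartan matrix of `A = KQ/I`: the `(i,j)`-entry is the Poincaré
polynomial `∑_n dim_K (e_i A e_j)_n qⁿ`, i.e. each nonzero path from `i` to `j`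
contributes `q^(its length)`. -/
noncomputable def qCartan : Matrix G.V G.V (Polynomial ℤ) := fun i j =>
  ∑ᶠ n : ℕ,
    (Nat.card {p : List G.A // p.length = n ∧ G.IsNonzeroPathFrom i j p} : Polynomial ℤ) *
      Polynomial.X ^ n

/-- The ordinary Cartan matrix of `A = KQ/I`: the `(i,j)`-entry is
`dim_K e_i A e_j`, the number of nonzero paths from `i` to `j`. -/
noncomputable def cartan : Matrix G.V G.V ℤ := fun i j =>
  (Nat.card {p : List G.A // G.IsNonzeroPathFrom i j p} : ℤ)

/-- An oriented cycle with full zero relations, recorded as the (nonempty) list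
of its arrows: any two cyclically consecutive arrows form a relation (this in
particular forces consecutive arrows to be composable, and the start and end
points to agree). -/
def IsZeroCycle (p : List G.A) : Prop :=
  p ≠ [] ∧ ∀ i : Fin p.length,
    G.rel (p.get i) (p.get ⟨(i.1 + 1) % p.length,
      Nat.mod_lt _ (Nat.lt_of_le_of_lt (Nat.zero_le _) i.2)⟩)

/-- A minimal oriented cycle with full zero relations: its arrows are pairwise
distinct. -/
def IsMinZeroCycle (p : List G.A) : Prop := G.IsZeroCycle p ∧ p.Nodup

/-- Lists satisfying a property, up to cyclic rotation. Oriented cycles are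
sequences of arrows up to cyclic rotation. -/
def cycleSetoid (P : List G.A → Prop) : Setoid {p : List G.A // P p} :=
  Setoid.comap Subtype.val (List.IsRotated.setoid G.A)

/-- `c_k`, the number of minimal oriented `k`-cycles in `Q` with full zero
relations (cycles being counted up to cyclic rotation). -/
noncomputable def numCycles (k : ℕ) : ℕ :=
  Nat.card (Quotient (G.cycleSetoid (fun p => G.IsMinZeroCycle p ∧ p.length = k)))

/-- The total number of minimal oriented cycles in `Q` with full zero relations. -/
noncomputable def totalCycles : ℕ :=
  Nat.card (Quotient (G.cycleSetoid (fun p => G.IsMinZeroCycle p)))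

/-- `ec(Q,I)`, the number of minimal oriented cycles with full zero relations
of even length. -/
noncomputable def ec : ℕ :=
  Nat.card (Quotient (G.cycleSetoid (fun p => G.IsMinZeroCycle p ∧ Even p.length)))

/-- `oc(Q,I)`, the number of minimal oriented cycles with full zero relations
of odd length. -/
noncomputable def oc : ℕ :=
  Nat.card (Quotient (G.cycleSetoid (fun p => G.IsMinZeroCycle p ∧ Odd p.length)))

end QuivRel

/-- Two square matrices over a commutative ring are unimodularly equivalent if
they differ by multiplication by matrices of determinant `1` on either side. -/
def UnimodEquiv {n : Type} [Fintype n] [DecidableEq n] {R : Type} [CommRing R]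
    (C D : Matrix n n R) : Prop :=
  ∃ P Q : Matrix n n R, P.det = 1 ∧ Q.det = 1 ∧ D = P * C * Q

/-- The quiver with relations `(Q^sp, I^sp)` obtained from `(Q,I)` by adding a
loop with square zero at each vertex of `Sp`. -/
def QuivRel.addLoops (G : QuivRel) (Sp : Finset G.V) : QuivRel where
  V := G.V
  A := G.A ⊕ {v : G.V // v ∈ Sp}
  src := Sum.elim G.src (fun v => v.1)
  tgt := Sum.elim G.tgt (fun v => v.1)
  rel a b :=
    match a, b with
    | Sum.inl a, Sum.inl b => G.rel a b
    | Sum.inr v, Sum.inr w => v = w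
    | _, _ => False
  rel_comp a b h := by
    cases a <;> cases b
    · exact G.rel_comp _ _ h
    · exact h.elim
    · exact h.elim
    · exact congrArg Subtype.val h

namespace QuivRel

variable {G : QuivRel} {v : G.V} {p : List G.A}

/-- An arrow of `G`, as an arrow of the quiver obtained by adding loops. -/
def addLoopsArrow (S : Finset G.V) (a : G.A) : (G.addLoops S).A := Sum.inl a

/-- The loop added at `v`. -/
def addedLoop (v : G.V) : (G.addLoops {v}).A := Sum.inr ⟨v, Finset.mem_singleton_self v⟩

/-- A nonzero cyclic path at `v`, followed by the loop added at `v`, can be prepended to itself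
any number of times without creating a relation. -/
theorem IsNonzeroPathFrom.isNonzeroPath_addLoops_iterate (hp : G.IsNonzeroPathFrom v v p)
    (hne : p ≠ []) (n : ℕ) :
    (G.addLoops {v}).IsNonzeroPath
      (List.replicate n (p.map (addLoopsArrow {v}) ++ [addedLoop v])).flatten := by
  obtain ⟨hchain, hhead, hlast, -⟩ := hp
  unfold IsNonzeroPath at hchain ⊢
  have hblock : List.IsChain
      (fun a b : (G.addLoops {v}).A =>
        (G.addLoops {v}).tgt a = (G.addLoops {v}).src b ∧ ¬ (G.addLoops {v}).rel a b)
      (p.map (addLoopsArrow {v}) ++ [addedLoop v]) := by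
    rw [List.isChain_append]
    refine ⟨(List.isChain_map _).2 hchain, List.isChain_singleton _, ?_⟩
    intro x hx y hy
    rw [List.getLast?_map, Option.mem_def, Option.map_eq_some_iff] at hx
    obtain ⟨a, ha, rfl⟩ := hx
    obtain rfl : addedLoop v = y := by simpa using hy
    exact ⟨hlast a ha, id⟩
  induction n with
  | zero => exact List.isChain_nil
  | succ n ih =>
    rw [List.replicate_succ, List.flatten_cons]
    refine List.isChain_append.2 ⟨hblock, ih, ?_⟩
    intro x hx y hy
    obtain rfl : addedLoop v = x := by simpa using hx
    obtain ⟨a, q, rfl⟩ := List.exists_cons_of_ne_nil hne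
    cases n with
    | zero => simp at hy
    | succ n =>
      obtain rfl : addLoopsArrow {v} a = y := by simpa [List.replicate_succ] using hy
      exact ⟨(hhead a rfl).symm, id⟩

/-- If adding a loop at `v` with square zero keeps the algebra finite-dimensional, then every
nonzero cyclic path at `v` is trivial. -/
theorem FinDim.not_isNonzeroPathFrom_self (hfd : (G.addLoops {v}).FinDim) (hne : p ≠ []) :
    ¬ G.IsNonzeroPathFrom v v p := by
  intro hp
  obtain ⟨N, hN⟩ := hfd
  have h := hN _ (hp.isNonzeroPath_addLoops_iterate hne (N + 1))
  simp only [List.length_flatten, List.map_replicate, List.sum_replicate, List.length_append,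
    List.length_map, List.length_singleton, smul_eq_mul] at h
  nlinarith [Nat.zero_le (N * p.length)]

/-- The diagonal entry of the `q`-Cartan matrix at a vertex without nontrivial nonzero cyclic
paths is `1`. -/
theorem qCartan_self_eq_one (h : ∀ p : List G.A, p ≠ [] → ¬ G.IsNonzeroPathFrom v v p) :
    G.qCartan v v = 1 := by
  unfold qCartan
  rw [finsum_eq_single _ 0]
  · have hnil : G.IsNonzeroPathFrom v v [] :=
      ⟨List.isChain_nil, by simp, by simp, fun _ => rfl⟩
    have : Unique {p : List G.A // p.length = 0 ∧ G.IsNonzeroPathFrom v v p} :=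
      { default := ⟨[], rfl, hnil⟩
        uniq := fun p => Subtype.ext (List.length_eq_zero_iff.1 p.2.1) }
    rw [Nat.card_unique, Nat.cast_one, pow_zero, mul_one]
  · intro n hn
    have : IsEmpty {p : List G.A // p.length = n ∧ G.IsNonzeroPathFrom v v p} :=
      ⟨fun ⟨p, hlen, hp⟩ => h p (by rintro rfl; exact hn hlen.symm) hp⟩
    rw [Nat.card_of_isEmpty, Nat.cast_zero, zero_mul]

end QuivRel

/-- Let `(Q,I)` be a gentle quiver with `A = KQ/I` finite-dimensional, and let
`v` be a vertex such that the pair obtained by adding a loop with square zero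
at `v` is again gentle (and finite-dimensional), i.e. `v` may be chosen as a
special vertex for a covering skewed-gentle quiver.  Then the diagonal entry of
the `q`-Cartan matrix at `v` equals `1`; equivalently, the only cyclic path at
`v` which is nonzero in `A` is the trivial path. -/
theorem qCartan_diag_special_vertex (G : QuivRel) (hG : G.Gentle) (hfd : G.FinDim)
    (v : G.V) (hsp : (G.addLoops {v}).Gentle ∧ (G.addLoops {v}).FinDim) :
    G.qCartan v v = 1 ∧
      ∀ p : List G.A, p ≠ [] → ¬ G.IsNonzeroPathFrom v v p := by
  have h : ∀ p : List G.A, p ≠ [] → ¬ G.IsNonzeroPathFrom v v p :=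
    fun _ hne => hsp.2.not_isNonzeroPathFrom_self hne
  exact ⟨QuivRel.qCartan_self_eq_one h, h⟩
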